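/- arXiv:math/0607715 — 5 statements merged into one kernel-verified Lean document; each statement's English description precedes it below -/
import Mathlib

section
/- Let n be a positive integer, let w ∈ ℝⁿ have all nonzero components, and let θ be a positive real number. Setting v := (w₁,…,wₙ,θ) ∈ ℝ^{n+1}, one has vol_n(S_{w,θ}ⁿ ∩ Cⁿ) = (1/(2ⁿ n! ∏_{i=1}^n wᵢ)) Σ_{s ∈ V_{n+1}} ε_s (v·s)₊ⁿ. -/
open MeasureTheory Finset

/-- Repeated antidifferentiation evaluates integrals over a centered cube of functions of a
linear form. -/
theorem integral_pi_comp_sub_sum_mul {f : ℕ → ℝ → ℝ} (hmeas : Measurable (f 0)) {C : ℝ}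
    (hbdd : ∀ r, ‖f 0 r‖ ≤ C)
    (h_int : ∀ n a b, IntervalIntegrable (f n) volume a b)
    (hanti : ∀ n a b, ∫ r in a..b, f n r = f (n + 1) b - f (n + 1) a)
    (n : ℕ) (w : Fin n → ℝ) (hw : ∀ i, w i ≠ 0) (u : ℝ) :
    ∫ x, f 0 (u - ∑ i, w i * x i)
        ∂(Measure.pi fun _ : Fin n => volume.restrict (Set.Icc (-(1/2 : ℝ)) (1/2))) =
      (∏ i, w i)⁻¹ * ∑ s : Fin n → Bool, (∏ i, (if s i then (1 : ℝ) else -1)) *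
        f n (u + (∑ i, w i * (if s i then (1 : ℝ) else -1)) / 2) := by
  induction n generalizing u with
  | zero => simp [measureReal_def]
  | succ n ih =>
    have hstep : ∀ a c : ℝ, c ≠ 0 → ∫ t in Set.Icc (-(1/2 : ℝ)) (1/2), f n (a - c * t) =
        c⁻¹ * (f (n + 1) (a + c / 2) - f (n + 1) (a - c / 2)) := by
      intro a c hc
      rw [integral_Icc_eq_integral_Ioc, ← intervalIntegral.integral_of_le (by norm_num),
        intervalIntegral.integral_comp_sub_mul _ hc, hanti, smul_eq_mul]
      congr 4 <;> ring
    have hstep_int : ∀ a c : ℝ, c ≠ 0 → IntegrableOn (fun t => f n (a - c * t))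
        (Set.Icc (-(1/2 : ℝ)) (1/2)) := by
      intro a c hc
      have h := ((h_int n (a - c * -(1/2)) (a - c * (1/2))).comp_sub_left a).comp_mul_left (c := c)
      rw [integrableOn_Icc_iff_integrableOn_Ioc,
        ← intervalIntegrable_iff_integrableOn_Ioc_of_le (by norm_num)]
      convert h using 1 <;> field_simp <;> ring
    have hmp := measurePreserving_piFinSuccAbove
      (fun _ : Fin (n + 1) => volume.restrict (Set.Icc (-(1/2 : ℝ)) (1/2))) 0
    rw [← hmp.symm.integral_comp' (fun x => f 0 (u - ∑ i, w i * x i)), integral_prod]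
    · have hinner : ∀ t : ℝ, (∫ y, f 0 (u - ∑ i, w i *
          (MeasurableEquiv.piFinSuccAbove (fun _ : Fin (n + 1) => ℝ) 0).symm (t, y) i)
          ∂(Measure.pi fun _ : Fin n => volume.restrict (Set.Icc (-(1/2 : ℝ)) (1/2)))) =
          (∏ i : Fin n, w i.succ)⁻¹ * ∑ s : Fin n → Bool,
            (∏ i, (if s i then (1 : ℝ) else -1)) *
            f n ((u + (∑ i, w i.succ * (if s i then (1 : ℝ) else -1)) / 2) - w 0 * t) := by
        intro t
        have h := ih (fun i => w i.succ) (fun i => hw _) (u - w 0 * t)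
        have hcons : ∀ y : Fin n → ℝ,
            (MeasurableEquiv.piFinSuccAbove (fun _ : Fin (n + 1) => ℝ) 0).symm (t, y) =
              (Fin.cons t y : Fin (n + 1) → ℝ) := fun y => Fin.insertNth_zero' t y
        simp only [hcons, Fin.sum_univ_succ, Fin.cons_zero, Fin.cons_succ]
        simp only [sub_sub] at h ⊢
        rw [h]
        congr 1
        refine Finset.sum_congr rfl fun s _ => ?_
        congr 2
        ring
      rw [integral_congr_ae (Filter.Eventually.of_forall hinner), integral_const_mul,
        integral_finsetSum _ fun s _ => (hstep_int _ _ (hw 0)).const_mul _]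
      simp only [integral_const_mul, hstep _ _ (hw 0)]
      rw [← (Fin.consEquiv fun _ : Fin (n + 1) => Bool).sum_comp, Fintype.sum_prod_type,
        Fintype.sum_bool, ← Finset.sum_add_distrib]
      simp only [Fin.consEquiv_apply, Fin.prod_univ_succ, Fin.sum_univ_succ, Fin.cons_zero,
        Fin.cons_succ, mul_inv, Finset.mul_sum]
      refine Finset.sum_congr rfl fun s _ => ?_
      simp only [if_true, Bool.false_eq_true, if_false]
      ring_nf
    · refine Integrable.of_bound (C := C) ?_ (Filter.Eventually.of_forall fun p => hbdd _)
      refine Measurable.aestronglyMeasurable (hmeas.comp ?_)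
      have hm := (MeasurableEquiv.piFinSuccAbove (fun _ : Fin (n + 1) => ℝ) 0).symm.measurable
      exact measurable_const.sub (Finset.measurable_sum _ fun i _ =>
        ((measurable_pi_apply i).comp hm).const_mul _)

/-- Away from zero, the derivative of the truncated power `r ↦ r₊ⁿ⁺¹ / (n + 1)!` is the
truncated power of one degree less. -/
theorem hasDerivAt_max_zero_pow_div_factorial (n : ℕ) {r : ℝ} (hr : r ≠ 0) :
    HasDerivAt (fun x : ℝ => (max x 0) ^ (n + 1) / (n + 1).factorial)
      (if 0 ≤ r then r ^ n / n.factorial else 0) r := by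
  rcases hr.lt_or_gt with h | h
  · rw [if_neg h.not_ge]
    refine (hasDerivAt_const r (0 : ℝ)).congr_of_eventuallyEq ?_
    filter_upwards [eventually_lt_nhds h] with x hx
    simp [max_eq_right hx.le]
  · rw [if_pos h.le]
    have hd := (hasDerivAt_pow (n + 1) r).div_const ((n + 1).factorial : ℝ)
    refine (hd.congr_deriv ?_).congr_of_eventuallyEq ?_
    · rw [Nat.factorial_succ]
      push_cast
      have : (n : ℝ) + 1 ≠ 0 := by positivity
      field_simp
    · filter_upwards [eventually_gt_nhds h] with x hx
      simp [max_eq_left hx.le]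

/-- The indicator of `[-θ/2, θ/2]` followed by its successive antiderivatives. -/
noncomputable def slabAntideriv (θ : ℝ) : ℕ → ℝ → ℝ
  | 0 => (Set.Icc (-(θ / 2)) (θ / 2)).indicator 1
  | n + 1 => fun r => (max (r + θ / 2) 0) ^ (n + 1) / (n + 1).factorial -
      (max (r - θ / 2) 0) ^ (n + 1) / (n + 1).factorial

theorem continuous_slabAntideriv_succ (θ : ℝ) (n : ℕ) :
    Continuous (slabAntideriv θ (n + 1)) := by
  unfold slabAntideriv
  fun_prop

theorem intervalIntegrable_slabAntideriv (θ : ℝ) (n : ℕ) (a b : ℝ) :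
    IntervalIntegrable (slabAntideriv θ n) volume a b := by
  cases n with
  | zero =>
    have h : IntegrableOn (slabAntideriv θ 0) (Set.uIcc a b) :=
      ((integrableOn_const (μ := volume) (s := Set.uIcc a b) (C := (1 : ℝ))
        isCompact_uIcc.measure_lt_top.ne)).indicator measurableSet_Icc
    exact h.intervalIntegrable
  | succ n => exact (continuous_slabAntideriv_succ θ n).intervalIntegrable a b

theorem hasDerivAt_slabAntideriv_succ {θ : ℝ} (hθ : 0 < θ) (n : ℕ) {r : ℝ}
    (h₁ : r ≠ -(θ / 2)) (h₂ : r ≠ θ / 2) :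
    HasDerivAt (slabAntideriv θ (n + 1)) (slabAntideriv θ n r) r := by
  have hp : r + θ / 2 ≠ 0 := fun h => h₁ (by linarith)
  have hm : r - θ / 2 ≠ 0 := fun h => h₂ (by linarith)
  have hd := ((hasDerivAt_max_zero_pow_div_factorial n hp).comp_add_const r (θ / 2)).sub
    ((hasDerivAt_max_zero_pow_div_factorial n hm).comp_sub_const r (θ / 2))
  refine hd.congr_deriv ?_
  cases n with
  | zero =>
    simp only [slabAntideriv, Set.indicator_apply, Set.mem_Icc, Pi.one_apply, pow_zero,
      Nat.factorial_zero, Nat.cast_one, div_one]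
    rcases h₁.lt_or_gt with h₁ | h₁ <;> rcases h₂.lt_or_gt with h₂ | h₂ <;>
      split_ifs <;> grind
  | succ n =>
    simp only [slabAntideriv]
    congr 1
    all_goals
      split_ifs with h
      · rw [max_eq_left h]
      · rw [max_eq_right (not_le.mp h).le]
        simp

theorem integral_slabAntideriv {θ : ℝ} (hθ : 0 < θ) (n : ℕ) (a b : ℝ) :
    ∫ r in a..b, slabAntideriv θ n r =
      slabAntideriv θ (n + 1) b - slabAntideriv θ (n + 1) a := by
  refine integral_eq_of_hasDerivAt_off_countable (slabAntideriv θ (n + 1)) _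
    (s := {-(θ / 2), θ / 2}) (Set.to_countable _)
    (continuous_slabAntideriv_succ θ n).continuousOn ?_
    (intervalIntegrable_slabAntideriv θ n a b)
  rintro r ⟨-, hr⟩
  simp only [Set.mem_insert_iff, Set.mem_singleton_iff, not_or] at hr
  exact hasDerivAt_slabAntideriv_succ hθ n hr.1 hr.2

/-- Pólya's formula for the volume of a central slab of the centered unit hypercube:
with `v = (w₁,…,wₙ,θ)`,
`vol_n(S_{w,θ}^n ∩ C^n) = (1/(2^n n! ∏ wᵢ)) ∑_{s ∈ V_{n+1}} ε_s (v·s)₊^n`. -/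
theorem volume_centralSlab_inter_centeredCube
    (n : ℕ) (hn : 0 < n) (w : Fin n → ℝ) (hw : ∀ i, w i ≠ 0) (θ : ℝ) (hθ : 0 < θ) :
    (volume ({x : Fin n → ℝ | |∑ i, w i * x i| ≤ θ / 2} ∩
        Set.Icc (fun _ => -(1/2 : ℝ)) (fun _ => (1/2 : ℝ)))).toReal =
      (1 / ((2 : ℝ) ^ n * (n.factorial : ℝ) * ∏ i, w i)) *
        ∑ s : Fin (n + 1) → Bool,
          (∏ i, (if s i then (1 : ℝ) else -1)) *
            (max (∑ i, (Fin.snoc w θ : Fin (n + 1) → ℝ) i * (if s i then (1 : ℝ) else -1))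
              0) ^ n := by
  have hS : MeasurableSet {x : Fin n → ℝ | |∑ i, w i * x i| ≤ θ / 2} :=
    measurableSet_le (by fun_prop) measurable_const
  have hvol : (volume ({x : Fin n → ℝ | |∑ i, w i * x i| ≤ θ / 2} ∩
        Set.Icc (fun _ => -(1/2 : ℝ)) (fun _ => (1/2 : ℝ)))).toReal =
      ∫ x, slabAntideriv θ 0 (0 - ∑ i, w i * x i)
        ∂(Measure.pi fun _ : Fin n => volume.restrict (Set.Icc (-(1/2 : ℝ)) (1/2))) := by
    rw [← Measure.restrict_pi_pi, ← volume_pi, Set.pi_univ_Icc, ← Measure.restrict_apply hS]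
    change Measure.real _ _ = _
    rw [← integral_indicator_one hS]
    congr 1 with x
    simp only [slabAntideriv, Set.indicator_apply, Set.mem_ofPred_eq, Set.mem_Icc, zero_sub,
      ← abs_le, abs_neg, Pi.one_apply]
  rw [hvol, integral_pi_comp_sub_sum_mul (C := 1)
    (measurable_one.indicator measurableSet_Icc) (fun r => ?_)
    (intervalIntegrable_slabAntideriv θ) (integral_slabAntideriv hθ) n w hw]
  · obtain ⟨m, rfl⟩ := Nat.exists_eq_add_one_of_ne_zero hn.ne'
    have hmax : ∀ r : ℝ, max (r / 2) 0 = max r 0 / 2 := fun r => by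
      rw [max_div_div_right (by norm_num : (0 : ℝ) ≤ 2) r 0 |>.symm, zero_div]
    rw [← (Fin.snocEquiv fun _ : Fin (m + 1 + 1) => Bool).sum_comp, Fintype.sum_prod_type,
      Fintype.sum_bool, ← Finset.sum_add_distrib, Finset.mul_sum, Finset.mul_sum]
    refine Finset.sum_congr rfl fun s _ => ?_
    simp only [Fin.snocEquiv_apply, Fin.prod_univ_castSucc (n := m + 1),
      Fin.sum_univ_castSucc (n := m + 1), Fin.snoc_castSucc, Fin.snoc_last, if_true,
      Bool.false_eq_true, if_false, slabAntideriv, zero_add, ← add_div, ← sub_div, hmax, div_pow,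
      mul_one, mul_neg, ← sub_eq_add_neg, one_div, mul_inv]
    ring
  · refine (norm_indicator_le_norm_self _ _).trans ?_
    simp
end

section
/- Let n be a positive integer, let w ∈ ℝⁿ have all nonzero components, and let θ be a positive real number. Then vol_n(S_{w,θ}ⁿ ∩ Cⁿ) = (2/π) ∫₀^∞ (sin(θx)/x) ∏_{i=1}^n (sin(wᵢ x)/(wᵢ x)) dx. -/
open MeasureTheory Finset Real

open scoped FourierTransform

/-- The Fourier transform of the indicator of a centered interval. -/
theorem integral_Icc_cexp_mul_I {r : ℝ} (hr : 0 ≤ r) (a : ℝ) :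
    ∫ t in Set.Icc (-r) r, Complex.exp (a * t * Complex.I) = 2 * r * Real.sinc (a * r) := by
  rw [integral_Icc_eq_integral_Ioc, ← intervalIntegral.integral_of_le (by linarith)]
  rcases eq_or_ne a 0 with rfl | ha
  · simp; ring
  · have h := intervalIntegral.integral_comp_mul_left (a := -r) (b := r)
      (fun t : ℝ => Complex.exp (t * Complex.I)) ha
    have hac : (a : ℂ) ≠ 0 := by exact_mod_cast ha
    simp only [Complex.ofReal_mul, mul_neg] at h
    rw [h, integral_exp_mul_I_eq_sinc, Complex.real_smul]
    push_cast
    field_simp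

/-- **Inversion formula** for the mass given to a centered interval by a finite measure on `ℝ`
whose characteristic function decays fast enough. -/
theorem measureReal_Icc_eq_integral_sinc_mul_charFun {ν : Measure ℝ} [IsFiniteMeasure ν]
    {r : ℝ} (hr : 0 < r) (hpos : ν {r} = 0) (hneg : ν {-r} = 0)
    (hintegrable : Integrable fun ξ : ℝ => (Real.sinc (r * ξ) : ℂ) * charFun ν ξ) :
    (ν.real (Set.Icc (-r) r) : ℂ) = (r / π) * ∫ ξ : ℝ, Real.sinc (r * ξ) * charFun ν ξ := by
  let χ : ℝ → ℂ := (Set.Icc (-r) r).indicator 1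
  have hχm : Measurable χ := measurable_one.indicator measurableSet_Icc
  have hχb (x : ℝ) : ‖χ x‖ ≤ 1 := by
    simp only [χ, Set.indicator_apply]; split_ifs <;> simp
  have hχi : Integrable χ :=
    (integrable_indicator_iff measurableSet_Icc).2 (by simp [Pi.one_def])
  let G : ℝ → ℂ := fun t => ∫ s, χ (s - t) ∂ν
  have hprod : Integrable (fun p : ℝ × ℝ => χ (p.2 - p.1)) (volume.prod ν) := by
    have hm : Measurable fun p : ℝ × ℝ => χ (p.2 - p.1) :=
      hχm.comp (measurable_snd.sub measurable_fst)
    refine (integrable_prod_iff' hm.aestronglyMeasurable).2 ⟨?_, ?_⟩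
    · exact Filter.Eventually.of_forall fun s => hχi.comp_sub_left s
    · have (s : ℝ) : ∫ t, ‖χ (s - t)‖ = ∫ t, ‖χ t‖ :=
        integral_sub_left_eq_self (fun t => ‖χ t‖) volume s
      simp only [this]
      exact integrable_const _
  have hGi : Integrable G := hprod.integral_prod_left
  have hGc : ContinuousAt G 0 := by
    refine continuousAt_of_dominated (bound := fun _ => 1) ?_ ?_ (integrable_const _) ?_
    · exact Filter.Eventually.of_forall fun t =>
        (hχm.comp (measurable_id.sub_const t)).aestronglyMeasurable
    · exact Filter.Eventually.of_forall fun t => Filter.Eventually.of_forall fun s => hχb _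
    · have h1 : ∀ᵐ s ∂ν, s ≠ r := by simpa [ae_iff] using hpos
      have h2 : ∀ᵐ s ∂ν, s ≠ -r := by simpa [ae_iff] using hneg
      filter_upwards [h1, h2] with s hs1 hs2
      have hc : ContinuousAt (fun t : ℝ => s - t) 0 := by fun_prop
      refine ContinuousAt.comp' (g := χ) ?_ hc
      rw [sub_zero]
      refine continuous_one.continuousOn.continuousAt_indicator ?_
      rw [frontier_Icc (by linarith)]
      simp [hs1, hs2]
  have hGF (ξ : ℝ) : 𝓕 G ξ =
      2 * r * ((Real.sinc (r * (-2 * π * ξ)) : ℂ) * charFun ν (-2 * π * ξ)) := by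
    rw [Real.fourier_real_eq_integral_exp_smul]
    simp only [G, smul_eq_mul, ← integral_const_mul]
    rw [integral_integral_swap]
    · have (s : ℝ) : ∫ t : ℝ, Complex.exp ((-2 * π * t * ξ : ℝ) * Complex.I) * χ (s - t) =
          2 * r * Real.sinc (r * (-2 * π * ξ)) *
            Complex.exp ((-2 * π * ξ : ℝ) * s * Complex.I) := by
        rw [← integral_sub_left_eq_self _ volume s]
        have h (t : ℝ) : Complex.exp ((-2 * π * (s - t) * ξ : ℝ) * Complex.I) * χ (s - (s - t)) =
            Complex.exp ((-2 * π * ξ : ℝ) * s * Complex.I) * (Set.Icc (-r) r).indicator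
              (fun t : ℝ => Complex.exp ((2 * π * ξ : ℝ) * t * Complex.I)) t := by
          simp only [χ, Set.indicator_apply, sub_sub_cancel]
          split_ifs
          · rw [← Complex.exp_add, Pi.one_apply, mul_one]
            push_cast
            ring_nf
          · simp
        simp only [h, integral_const_mul]
        rw [integral_indicator measurableSet_Icc, integral_Icc_cexp_mul_I hr.le,
          ← Real.sinc_neg]
        ring_nf
      simp only [this, integral_const_mul, charFun_apply_real]
      ring
    · refine hprod.bdd_mul (c := 1) (by fun_prop) ?_
      exact Filter.Eventually.of_forall fun p => (Complex.norm_exp_ofReal_mul_I _).le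
  have hGFi : Integrable (𝓕 G) := by
    have h := (hintegrable.comp_mul_left' (R := -2 * π) (by simp [pi_ne_zero])).const_mul (2 * r : ℂ)
    exact h.congr (Filter.Eventually.of_forall fun ξ => (hGF ξ).symm)
  have hinv := hGi.fourierInv_fourier_eq hGFi hGc
  have hG0 : G 0 = ν.real (Set.Icc (-r) r) := by
    simp only [G, sub_zero, χ]
    simp [integral_indicator measurableSet_Icc]
  rw [← hG0, ← hinv, Real.fourierInv_eq']
  simp only [inner_zero_right, mul_zero, Complex.ofReal_zero, zero_mul, Complex.exp_zero,
    one_smul, hGF, integral_const_mul]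
  rw [Measure.integral_comp_mul_left
    (fun ξ : ℝ => (Real.sinc (r * ξ) : ℂ) * charFun ν ξ) (-2 * π), Complex.real_smul]
  have : |(-2 * π)⁻¹| = (2 * π)⁻¹ := by
    rw [neg_mul, inv_neg, abs_neg, abs_of_pos (by positivity)]
  have hπ : (π : ℂ) ≠ 0 := by exact_mod_cast pi_ne_zero
  rw [this]
  push_cast
  field_simp

/-- A hyperplane with a nonzero normal vector is Lebesgue-null. -/
theorem volume_sum_mul_eq_const {ι : Type*} [Fintype ι] {w : ι → ℝ} {i : ι} (hi : w i ≠ 0)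
    (c : ℝ) : volume {x : ι → ℝ | ∑ j, w j * x j = c} = 0 := by
  classical
  let L : (ι → ℝ) →ₗ[ℝ] ℝ := ∑ j, w j • LinearMap.proj j
  have hL (x : ι → ℝ) : L x = ∑ j, w j * x j := by simp [L]
  have hsurj : Function.Surjective L := fun y =>
    ⟨Pi.single i (y / w i), by simp [hL, Pi.single_apply, mul_div_cancel₀ _ hi]⟩
  obtain ⟨k, _, hk⟩ := L.exists_map_addHaar_eq_smul_addHaar volume volume hsurj
  have hm : Measurable L := L.continuous_of_finiteDimensional.measurable
  have h := congrArg (fun μ : Measure ℝ => μ {c}) hk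
  simp only [Measure.map_apply hm (measurableSet_singleton c), Measure.smul_apply] at h
  simpa [Set.preimage, hL] using h

/-- The characteristic function of a linear form on the centered unit cube. -/
theorem charFun_map_sum_mul_cube {ι : Type*} [Fintype ι] (w : ι → ℝ) (ξ : ℝ) :
    charFun (((volume : Measure (ι → ℝ)).restrict
        (Set.Icc (fun _ => -(1/2 : ℝ)) (fun _ => (1/2 : ℝ)))).map fun x => ∑ i, w i * x i) ξ =
      ∏ i, (Real.sinc (w i * (ξ / 2)) : ℂ) := by
  rw [charFun_apply_real, integral_map (by fun_prop : Measurable _).aemeasurable (by fun_prop), ← Set.pi_univ_Icc,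
    volume_pi, Measure.restrict_pi_pi]
  have h (x : ι → ℝ) : Complex.exp (ξ * (∑ i, w i * x i : ℝ) * Complex.I) =
      ∏ i, Complex.exp ((ξ * w i : ℝ) * x i * Complex.I) := by
    rw [← Complex.exp_sum]
    push_cast
    rw [Finset.mul_sum, Finset.sum_mul]
    simp only [mul_assoc]
  simp only [h]
  rw [integral_fintype_prod_eq_prod (fun i (t : ℝ) =>
    Complex.exp ((ξ * w i : ℝ) * t * Complex.I))]
  refine Finset.prod_congr rfl fun i _ => ?_
  rw [integral_Icc_cexp_mul_I (by norm_num)]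
  push_cast
  ring_nf

/-- The product of two dilated `sinc` functions decays quadratically. -/
theorem abs_sinc_mul_sinc_le {a b : ℝ} (ha : a ≠ 0) (hb : b ≠ 0) (x : ℝ) :
    |Real.sinc (a * x) * Real.sinc (b * x)| ≤ (1 + |a * b|⁻¹) * (1 + x ^ 2)⁻¹ := by
  have h1 : |Real.sinc (a * x) * Real.sinc (b * x)| ≤ 1 := by
    rw [abs_mul]
    exact mul_le_one₀ (Real.abs_sinc_le_one _) (abs_nonneg _) (Real.abs_sinc_le_one _)
  have h2 : |Real.sinc (a * x) * Real.sinc (b * x)| * x ^ 2 ≤ |a * b|⁻¹ := by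
    rcases eq_or_ne x 0 with rfl | hx
    · simpa using mul_nonneg (inv_nonneg.2 (abs_nonneg b)) (inv_nonneg.2 (abs_nonneg a))
    rw [Real.sinc_of_ne_zero (by positivity), Real.sinc_of_ne_zero (by positivity), ← sq_abs x,
      abs_mul, abs_div, abs_div, abs_mul, abs_mul, abs_mul]
    have := mul_le_one₀ (abs_sin_le_one (a * x)) (abs_nonneg _) (abs_sin_le_one (b * x))
    have ha' := abs_pos.2 ha
    have hb' := abs_pos.2 hb
    have hx' := abs_pos.2 hx
    field_simp
    rwa [mul_comm x b]
  rw [← div_eq_mul_inv, le_div_iff₀ (by positivity)]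
  linarith

/-- A product of at least two dilated `sinc` functions is integrable. -/
theorem integrable_sinc_mul_prod_sinc {ι : Type*} [Fintype ι] [Nonempty ι] {θ : ℝ} (hθ : θ ≠ 0)
    {w : ι → ℝ} (hw : ∀ i, w i ≠ 0) :
    Integrable fun x : ℝ => Real.sinc (θ * x) * ∏ i, Real.sinc (w i * x) := by
  classical
  obtain ⟨j⟩ := ‹Nonempty ι›
  have hc : Continuous fun x : ℝ => Real.sinc (θ * x) * ∏ i, Real.sinc (w i * x) := by
    have := Real.continuous_sinc
    fun_prop
  refine (integrable_inv_one_add_sq.const_mul (1 + |θ * w j|⁻¹)).mono'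
    hc.aestronglyMeasurable (Filter.Eventually.of_forall fun x => ?_)
  refine le_trans ?_ (abs_sinc_mul_sinc_le hθ (hw j) x)
  rw [Real.norm_eq_abs, ← Finset.mul_prod_erase _ _ (Finset.mem_univ j), ← mul_assoc, abs_mul]
  refine mul_le_of_le_one_right (abs_nonneg _) ?_
  rw [Finset.abs_prod]
  exact Finset.prod_le_one (fun _ _ => abs_nonneg _) fun _ _ => Real.abs_sinc_le_one _

/-- Pólya's integral formula for the volume of a central slab of the centered unit cube:
`vol_n(S_{w,θ}^n ∩ C^n) = (2/π) ∫₀^∞ (sin θx / x) ∏ᵢ (sin wᵢx / (wᵢ x)) dx`. -/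
theorem volume_centralSlab_eq_sinc_integral
    (n : ℕ) (hn : 0 < n) (w : Fin n → ℝ) (hw : ∀ i, w i ≠ 0) (θ : ℝ) (hθ : 0 < θ) :
    (volume ({x : Fin n → ℝ | |∑ i, w i * x i| ≤ θ / 2} ∩
        Set.Icc (fun _ => -(1/2 : ℝ)) (fun _ => (1/2 : ℝ)))).toReal =
      (2 / π) * ∫ x in Set.Ioi (0 : ℝ),
        (Real.sin (θ * x) / x) * ∏ i, Real.sin (w i * x) / (w i * x) := by
  have : Nonempty (Fin n) := ⟨⟨0, hn⟩⟩
  set C : Set (Fin n → ℝ) := Set.Icc (fun _ => -(1/2 : ℝ)) (fun _ => (1/2 : ℝ)) with hC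
  set F : ℝ → ℝ := fun x => Real.sinc (θ * x) * ∏ i, Real.sinc (w i * x) with hF
  have : IsFiniteMeasure ((volume : Measure (Fin n → ℝ)).restrict C) :=
    ⟨by simpa [hC] using isCompact_Icc.measure_lt_top⟩
  have hm : Measurable fun x : Fin n → ℝ => ∑ i, w i * x i := by fun_prop
  set ν : Measure ℝ := (volume.restrict C).map fun x : Fin n → ℝ => ∑ i, w i * x i with hν
  have hatom (c : ℝ) : ν {c} = 0 := by
    rw [hν, Measure.map_apply hm (measurableSet_singleton c)]
    exact Measure.absolutelyContinuous_of_le Measure.restrict_le_self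
      (volume_sum_mul_eq_const (hw ⟨0, hn⟩) c)
  have hFc (ξ : ℝ) : (Real.sinc (θ / 2 * ξ) : ℂ) * charFun ν ξ = (F (2⁻¹ * ξ) : ℂ) := by
    rw [hν, charFun_map_sum_mul_cube, hF]
    push_cast
    ring_nf
  have hintegrable : Integrable fun ξ : ℝ => (F (2⁻¹ * ξ) : ℂ) :=
    ((integrable_sinc_mul_prod_sinc hθ.ne' hw).comp_mul_left' (by norm_num)).ofReal
  have hinv := measureReal_Icc_eq_integral_sinc_mul_charFun (ν := ν) (half_pos hθ) (hatom _)
    (hatom _) (by simpa only [hFc] using hintegrable)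
  simp only [hFc] at hinv
  rw [integral_complex_ofReal, Measure.integral_comp_mul_left F] at hinv
  have hvol : ν.real (Set.Icc (-(θ / 2)) (θ / 2)) =
      (volume ({x : Fin n → ℝ | |∑ i, w i * x i| ≤ θ / 2} ∩ C)).toReal := by
    rw [Measure.real, hν, Measure.map_apply hm measurableSet_Icc,
      Measure.restrict_apply (hm measurableSet_Icc)]
    congr 3
    ext x
    simp [abs_le]
  have hFabs (x : ℝ) : F |x| = F x := by
    rcases abs_choice x with h | h <;> simp [h, hF, Real.sinc_neg]
  have hhalf : ∫ x, F x = 2 * ∫ x in Set.Ioi (0 : ℝ), F x := by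
    simpa only [hFabs] using integral_comp_abs (f := F)
  have hsin : ∫ x in Set.Ioi (0 : ℝ), (Real.sin (θ * x) / x) *
      ∏ i, Real.sin (w i * x) / (w i * x) = θ * ∫ x in Set.Ioi (0 : ℝ), F x := by
    rw [← integral_const_mul]
    refine setIntegral_congr_fun measurableSet_Ioi fun x (hx : 0 < x) => ?_
    simp only [hF]
    rw [Real.sinc_of_ne_zero (by positivity), ← mul_assoc]
    congr 1
    · field_simp
    · exact Finset.prod_congr rfl fun i _ =>
        (Real.sinc_of_ne_zero (mul_ne_zero (hw i) hx.ne')).symm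
  rw [hsin, ← hvol]
  have hreal : ν.real (Set.Icc (-(θ / 2)) (θ / 2)) =
      θ / 2 / π * (|(2⁻¹ : ℝ)⁻¹| • ∫ x, F x) := by
    exact_mod_cast hinv
  rw [hreal, hhalf, smul_eq_mul, inv_inv, abs_of_pos two_pos]
  ring
end

section
/- Let n be a positive integer and let a₀, a₁, …, aₙ be positive real numbers. Then (2/π) ∫₀^∞ ∏_{i=0}^n (sin(aᵢ x)/x) dx = (1/(2ⁿ n!)) Σ_{s ∈ Vₙ} ε_s α_s (a₀ + Σ_{i=1}^n sᵢ aᵢ)ⁿ, where α_s equals 1, 0, or −1 according to whether a₀ + Σ_{i=1}^n sᵢ aᵢ is positive, zero, or negative. -/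
open MeasureTheory Finset Real

theorem hasDerivAt_exp_neg_mul_one_sub_cos {t : ℝ} (ht : 0 < t) (x : ℝ) :
    HasDerivAt (fun x => exp (-(t * x)) * (-1 + t / (1 + t ^ 2) * (t * cos x - sin x)))
      (t * (1 - cos x) * exp (-(t * x))) x := by
  have h1 : HasDerivAt (fun x => exp (-(t * x))) (exp (-(t * x)) * (-(t * 1))) x :=
    (((hasDerivAt_id x).const_mul t).neg).exp
  have h2 : HasDerivAt (fun x => -1 + t / (1 + t ^ 2) * (t * cos x - sin x))
      (t / (1 + t ^ 2) * (t * (-sin x) - cos x)) x :=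
    ((((hasDerivAt_cos x).const_mul t).sub (hasDerivAt_sin x)).const_mul _).const_add _
  convert! h1.mul h2 using 1
  field_simp
  ring

theorem tendsto_exp_neg_mul_one_sub_cos {t : ℝ} (ht : 0 < t) :
    Filter.Tendsto (fun x => exp (-(t * x)) * (-1 + t / (1 + t ^ 2) * (t * cos x - sin x)))
      Filter.atTop (nhds 0) := by
  have h1 : Filter.Tendsto (fun x : ℝ => exp (-(t * x))) Filter.atTop (nhds 0) :=
    tendsto_exp_neg_atTop_nhds_zero.comp (Filter.tendsto_id.const_mul_atTop ht)
  refine h1.zero_mul_isBoundedUnder_le ?_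
  refine Filter.isBoundedUnder_of ⟨1 + t / (1 + t ^ 2) * (t + 1), fun x => ?_⟩
  have h2 : |t * cos x - sin x| ≤ t + 1 := by
    have hc := mul_le_mul_of_nonneg_left (abs_cos_le_one x) ht.le
    calc |t * cos x - sin x| ≤ |t * cos x| + |sin x| := abs_sub _ _
      _ ≤ t + 1 := by
        rw [abs_mul, abs_of_pos ht]; linarith [abs_sin_le_one x]
  have h3 : 0 ≤ t / (1 + t ^ 2) := by positivity
  calc |(-1 + t / (1 + t ^ 2) * (t * cos x - sin x))|
      ≤ |(-1 : ℝ)| + |t / (1 + t ^ 2) * (t * cos x - sin x)| := abs_add_le _ _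
    _ ≤ _ := by
      rw [abs_mul, abs_of_nonneg h3, abs_neg, abs_one]
      gcongr

theorem integrableOn_mul_one_sub_cos_mul_exp {t : ℝ} (ht : 0 < t) :
    IntegrableOn (fun x => t * (1 - cos x) * exp (-(t * x))) (Set.Ioi 0) :=
  integrableOn_Ioi_deriv_of_nonneg' (fun x _ => hasDerivAt_exp_neg_mul_one_sub_cos ht x)
    (fun x _ => mul_nonneg (mul_nonneg ht.le (sub_nonneg.2 (cos_le_one x))) (exp_pos _).le)
    (tendsto_exp_neg_mul_one_sub_cos ht)

theorem integral_mul_one_sub_cos_mul_exp {t : ℝ} (ht : 0 < t) :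
    ∫ x in Set.Ioi (0 : ℝ), t * (1 - cos x) * exp (-(t * x)) = (1 + t ^ 2)⁻¹ := by
  rw [integral_Ioi_of_hasDerivAt_of_nonneg'
    (fun x _ => hasDerivAt_exp_neg_mul_one_sub_cos ht x)
    (fun x _ => mul_nonneg (mul_nonneg ht.le (sub_nonneg.2 (cos_le_one x))) (exp_pos _).le)
    (tendsto_exp_neg_mul_one_sub_cos ht)]
  simp
  field_simp
  ring

theorem integral_mul_exp_neg_mul {x : ℝ} (hx : 0 < x) :
    ∫ t in Set.Ioi (0 : ℝ), t * exp (-(t * x)) = 1 / x ^ 2 := by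
  have h := integral_rpow_mul_exp_neg_mul_Ioi (a := 2) (by norm_num) hx
  norm_num [Gamma_two] at h
  simpa [mul_comm x] using h

/-- Obtained by writing `1 / x ^ 2` as the Laplace integral `∫₀^∞ t * exp (-t x) dt` and swapping the
order of integration. -/
theorem integral_one_sub_cos_div_sq :
    ∫ x in Set.Ioi (0 : ℝ), (1 - cos x) / x ^ 2 = π / 2 := by
  set μ := volume.restrict (Set.Ioi (0 : ℝ)) with hμ
  have hint : Integrable (Function.uncurry fun t x : ℝ => t * (1 - cos x) * exp (-(t * x)))
      (μ.prod μ) := by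
    refine (integrable_prod_iff ?_).2 ⟨?_, ?_⟩
    · exact Continuous.aestronglyMeasurable (by unfold Function.uncurry; fun_prop)
    · filter_upwards [ae_restrict_mem measurableSet_Ioi] with t ht
      exact integrableOn_mul_one_sub_cos_mul_exp ht
    · refine (integrable_inv_one_add_sq.integrableOn (s := Set.Ioi 0)).congr ?_
      filter_upwards [ae_restrict_mem measurableSet_Ioi] with t ht
      rw [← integral_mul_one_sub_cos_mul_exp ht]
      refine integral_congr_ae (Filter.Eventually.of_forall fun x => ?_)
      exact (norm_of_nonneg (mul_nonneg (mul_nonneg (le_of_lt ht)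
        (sub_nonneg.2 (cos_le_one x))) (exp_pos _).le)).symm
  calc ∫ x in Set.Ioi (0 : ℝ), (1 - cos x) / x ^ 2
      = ∫ x in Set.Ioi (0 : ℝ), ∫ t in Set.Ioi (0 : ℝ), t * (1 - cos x) * exp (-(t * x)) := by
        refine setIntegral_congr_fun measurableSet_Ioi fun x hx => ?_
        simp only [mul_right_comm _ (1 - cos x)]
        rw [integral_mul_const, integral_mul_exp_neg_mul hx]
        ring
    _ = ∫ t in Set.Ioi (0 : ℝ), ∫ x in Set.Ioi (0 : ℝ), t * (1 - cos x) * exp (-(t * x)) :=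
        (integral_integral_swap hint).symm
    _ = ∫ t in Set.Ioi (0 : ℝ), (1 + t ^ 2)⁻¹ :=
        setIntegral_congr_fun measurableSet_Ioi fun t ht => integral_mul_one_sub_cos_mul_exp ht
    _ = π / 2 := by simp

theorem integral_one_sub_cos_mul_div_sq (t : ℝ) :
    ∫ x in Set.Ioi (0 : ℝ), (1 - cos (t * x)) / x ^ 2 = π / 2 * |t| := by
  rcases eq_or_ne t 0 with rfl | ht
  · simp
  have hp : 0 < |t| := abs_pos.2 ht
  have h := integral_comp_mul_left_Ioi (fun x => (1 - cos x) / x ^ 2) 0 hp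
  rw [mul_zero, integral_one_sub_cos_div_sq] at h
  calc ∫ x in Set.Ioi (0 : ℝ), (1 - cos (t * x)) / x ^ 2
      = ∫ x in Set.Ioi (0 : ℝ), |t| ^ 2 * ((1 - cos (|t| * x)) / (|t| * x) ^ 2) := by
        refine setIntegral_congr_fun measurableSet_Ioi fun x hx => ?_
        have hx' : x ≠ 0 := ne_of_gt hx
        have hc : cos (|t| * x) = cos (t * x) := by
          rcases abs_choice t with h | h <;> simp [h]
        simp only [hc]
        field_simp
    _ = π / 2 * |t| := by
        rw [integral_const_mul, h, smul_eq_mul]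
        field_simp

theorem abs_sin_mul_div_le (t x : ℝ) :
    |sin (t * x) / x| ≤ (1 + |t|) * (√(1 + x ^ 2))⁻¹ := by
  rw [← div_eq_mul_inv, le_div_iff₀ (by positivity)]
  rcases eq_or_ne x 0 with rfl | hx
  · simp; positivity
  refine abs_le_of_sq_le_sq' ?_ (by positivity) |>.2
  have h1 : sin (t * x) ^ 2 ≤ 1 := sin_sq_le_one _
  have h2 : sin (t * x) ^ 2 ≤ t ^ 2 * x ^ 2 := by
    rw [← mul_pow]; exact sin_sq_le_sq
  rw [mul_pow, sq_abs, sq_sqrt (by positivity), div_pow, div_mul_eq_mul_div,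
    div_le_iff₀ (by positivity)]
  nlinarith [sq_abs t, abs_nonneg t, mul_nonneg (abs_nonneg t) (sq_nonneg x), sq_nonneg x]

theorem exists_abs_prod_sin_mul_div_le {m : ℕ} (a : Fin (m + 1) → ℝ) :
    ∃ C, ∀ x, |∏ i, sin (a i * x) / x| ≤ C * (√(1 + x ^ 2))⁻¹ := by
  refine ⟨∏ i, (1 + |a i|), fun x => ?_⟩
  have h1 : (√(1 + x ^ 2))⁻¹ ≤ 1 :=
    inv_le_one_of_one_le₀ (Real.one_le_sqrt.2 (by nlinarith [sq_nonneg x]))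
  rw [abs_prod]
  calc ∏ i, |sin (a i * x) / x| ≤ ∏ i, (1 + |a i|) * (√(1 + x ^ 2))⁻¹ :=
        prod_le_prod (fun _ _ => abs_nonneg _) fun i _ => abs_sin_mul_div_le _ _
    _ = (∏ i, (1 + |a i|)) * (√(1 + x ^ 2))⁻¹ ^ (m + 1) := by
        rw [prod_mul_distrib]; simp
    _ ≤ _ := by
        gcongr
        exact pow_le_of_le_one (by positivity) h1 (by omega)

theorem integrable_sin_mul_div_mul_prod {m : ℕ} (a : Fin (m + 1) → ℝ) (u v : ℝ) :
    Integrable (Function.uncurry fun t x : ℝ => sin (t * x) / x * ∏ i, sin (a i * x) / x)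
      ((volume.restrict (Set.uIoc u v)).prod (volume.restrict (Set.Ioi 0))) := by
  obtain ⟨C, hC⟩ := exists_abs_prod_sin_mul_div_le a
  have hf : Integrable (fun t : ℝ => 1 + |t|) (volume.restrict (Set.uIoc u v)) :=
    (intervalIntegrable_iff.1 (Continuous.intervalIntegrable (by fun_prop) u v))
  have hg : Integrable (fun x : ℝ => C * (1 + x ^ 2)⁻¹) (volume.restrict (Set.Ioi 0)) :=
    (integrable_inv_one_add_sq.const_mul C).integrableOn
  refine (hf.mul_prod hg).mono' (Measurable.aestronglyMeasurable (by
    unfold Function.uncurry; fun_prop)) (Filter.Eventually.of_forall fun ⟨t, x⟩ => ?_)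
  have hs : (√(1 + x ^ 2))⁻¹ * (√(1 + x ^ 2))⁻¹ = (1 + x ^ 2)⁻¹ := by
    rw [← mul_inv, mul_self_sqrt (by positivity)]
  simp only [Function.uncurry, norm_mul, norm_eq_abs]
  calc |sin (t * x) / x| * |∏ i, sin (a i * x) / x|
      ≤ ((1 + |t|) * (√(1 + x ^ 2))⁻¹) * (C * (√(1 + x ^ 2))⁻¹) :=
        mul_le_mul (abs_sin_mul_div_le t x) (hC x) (abs_nonneg _) (by positivity)
    _ = (1 + |t|) * (C * (1 + x ^ 2)⁻¹) := by rw [← hs]; ring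

theorem integrableOn_one_sub_cos_mul_div_sq (t : ℝ) :
    IntegrableOn (fun x => (1 - cos (t * x)) / x ^ 2) (Set.Ioi 0) := by
  have hg : IntegrableOn (fun x : ℝ => 2 * (1 + |t / 2|) ^ 2 * (1 + x ^ 2)⁻¹) (Set.Ioi 0) :=
    (integrable_inv_one_add_sq.const_mul _).integrableOn
  refine hg.mono' (Measurable.aestronglyMeasurable (by fun_prop))
    (Filter.Eventually.of_forall fun x => ?_)
  have h : (1 - cos (t * x)) / x ^ 2 = 2 * |sin (t / 2 * x) / x| ^ 2 := by
    have hd : t * x = 2 * (t / 2 * x) := by ring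
    rw [sq_abs, div_pow, hd, cos_two_mul, cos_sq']
    ring
  rw [h, norm_of_nonneg (by positivity)]
  calc 2 * |sin (t / 2 * x) / x| ^ 2 ≤ 2 * ((1 + |t / 2|) * (√(1 + x ^ 2))⁻¹) ^ 2 := by
        gcongr; exact abs_sin_mul_div_le _ _
    _ = _ := by rw [mul_pow, inv_pow, sq_sqrt (by positivity)]; ring

theorem integral_sin_mul_div_mul_sin_mul_div (b c : ℝ) :
    ∫ x in Set.Ioi (0 : ℝ), sin (b * x) / x * (sin (c * x) / x) =
      π / 4 * (|b + c| - |b - c|) := by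
  calc ∫ x in Set.Ioi (0 : ℝ), sin (b * x) / x * (sin (c * x) / x)
      = ∫ x in Set.Ioi (0 : ℝ), 1 / 2 * ((1 - cos ((b + c) * x)) / x ^ 2 -
          (1 - cos ((b - c) * x)) / x ^ 2) := by
        congr 1 with x
        rw [add_mul, sub_mul, cos_add, cos_sub]
        ring
    _ = _ := by
        rw [integral_const_mul, integral_sub (integrableOn_one_sub_cos_mul_div_sq _)
          (integrableOn_one_sub_cos_mul_div_sq _), integral_one_sub_cos_mul_div_sq,
          integral_one_sub_cos_mul_div_sq]
        ring

theorem intervalIntegral_sin_mul_div (b c x : ℝ) :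
    ∫ t in (b - c)..(b + c), sin (t * x) / x = 2 * (sin (b * x) / x * (sin (c * x) / x)) := by
  rcases eq_or_ne x 0 with rfl | hx
  · simp
  rw [intervalIntegral.integral_div, intervalIntegral.integral_comp_mul_right _ hx, integral_sin,
    sub_mul, add_mul, cos_add, cos_sub, smul_eq_mul]
  field_simp
  ring

theorem hasDerivAt_abs_mul_self (y : ℝ) : HasDerivAt (fun y : ℝ => |y| * y) (2 * |y|) y := by
  rcases eq_or_ne y 0 with rfl | hy
  · rw [hasDerivAt_iff_tendsto_slope_zero]
    have h : Filter.Tendsto (fun t : ℝ => |t|) (nhdsWithin 0 {0}ᶜ) (nhds (2 * |(0 : ℝ)|)) := by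
      have := (continuous_abs (G := ℝ)).tendsto 0
      simp only [abs_zero, mul_zero] at this ⊢
      exact this.mono_left nhdsWithin_le_nhds
    refine h.congr' ?_
    filter_upwards [self_mem_nhdsWithin] with t ht
    have : t ≠ 0 := ht
    simp
    field_simp
  · convert! (hasDerivAt_abs hy).mul (hasDerivAt_id y) using 1
    rcases hy.lt_or_gt with h | h
    · simp [h, abs_of_neg h]; ring
    · simp [h, abs_of_pos h]; ring

theorem hasDerivAt_abs_mul_pow (m : ℕ) (y : ℝ) :
    HasDerivAt (fun y : ℝ => |y| * y ^ (m + 1)) ((m + 2) * (|y| * y ^ m)) y := by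
  have h := (hasDerivAt_abs_mul_self y).mul (hasDerivAt_pow m y)
  convert! h using 1
  · ext z
    simp only [Pi.mul_apply]
    ring
  · rcases m with _ | m
    · simp
    · push_cast
      ring

theorem intervalIntegral_abs_mul_pow (m : ℕ) (u v : ℝ) :
    ∫ t in u..v, |t| * t ^ m = (|v| * v ^ (m + 1) - |u| * u ^ (m + 1)) / (m + 2) := by
  have h := intervalIntegral.integral_eq_sub_of_hasDerivAt (a := u) (b := v)
    (fun y _ => hasDerivAt_abs_mul_pow m y) (Continuous.intervalIntegrable (by fun_prop) _ _)
  rw [intervalIntegral.integral_const_mul] at h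
  rw [← h]
  field_simp

theorem sum_fin_succ_bool {m : ℕ} (g : (Fin (m + 1) → Bool) → ℝ) :
    ∑ s, g s = ∑ s : Fin m → Bool, (g (Fin.cons true s) + g (Fin.cons false s)) := by
  rw [← (Fin.consEquiv fun _ => Bool).sum_comp, Fintype.sum_prod_type, Fintype.sum_bool,
    ← sum_add_distrib]
  rfl

/-- The sinc integral with one distinguished real frequency `b`. The induction step integrates the
identity in `b` over an interval, by Fubini. -/
theorem integral_sin_mul_div_mul_prod (m : ℕ) (b : ℝ) (a : Fin (m + 1) → ℝ) :
    ∫ x in Set.Ioi (0 : ℝ), sin (b * x) / x * ∏ i, sin (a i * x) / x =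
      π / 2 * (1 / (2 ^ (m + 1) * (m + 1).factorial)) *
        ∑ s : Fin (m + 1) → Bool, (∏ i, (if s i then (1 : ℝ) else -1)) *
          (|b + ∑ i, (if s i then (1 : ℝ) else -1) * a i| *
            (b + ∑ i, (if s i then (1 : ℝ) else -1) * a i) ^ m) := by
  induction m generalizing b with
  | zero =>
    rw [← (Equiv.funUnique (Fin 1) Bool).symm.sum_comp, Fintype.sum_bool]
    simp [integral_sin_mul_div_mul_sin_mul_div, sub_eq_add_neg]
    left
    ring
  | succ m ih =>
    set P : ℝ → ℝ := fun x => ∏ i : Fin (m + 1), sin (a i.succ * x) / x with hP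
    have hswap : ∫ t in (b - a 0)..(b + a 0), ∫ x in Set.Ioi (0 : ℝ), sin (t * x) / x * P x =
        ∫ x in Set.Ioi (0 : ℝ), ∫ t in (b - a 0)..(b + a 0), sin (t * x) / x * P x :=
      intervalIntegral_integral_swap (integrable_sin_mul_div_mul_prod _ _ _)
    calc ∫ x in Set.Ioi (0 : ℝ), sin (b * x) / x * ∏ i, sin (a i * x) / x
        = ∫ x in Set.Ioi (0 : ℝ), 1 / 2 * ∫ t in (b - a 0)..(b + a 0), sin (t * x) / x * P x := by
          congr 1 with x
          rw [intervalIntegral.integral_mul_const, intervalIntegral_sin_mul_div,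
            Fin.prod_univ_succ]
          ring
      _ = 1 / 2 * ∫ t in (b - a 0)..(b + a 0),
            ∫ x in Set.Ioi (0 : ℝ), sin (t * x) / x * P x := by
          rw [integral_const_mul, hswap]
      _ = _ := by
          simp only [hP, ih]
          rw [intervalIntegral.integral_const_mul, intervalIntegral.integral_finsetSum
              (fun s _ => Continuous.intervalIntegrable (by fun_prop) _ _),
            sum_fin_succ_bool fun s : Fin (m + 1 + 1) → Bool => _, mul_sum, mul_sum, mul_sum]
          refine sum_congr rfl fun s _ => ?_
          rw [intervalIntegral.integral_const_mul,
            intervalIntegral.integral_comp_add_right (fun y => |y| * y ^ m),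
            intervalIntegral_abs_mul_pow, Nat.factorial_succ (m + 1)]
          simp only [Fin.prod_univ_succ, Fin.sum_univ_succ, Fin.cons_zero,
            Fin.cons_succ]
          simp only [if_true, Bool.false_eq_true, if_false]
          push_cast
          rw [← add_assoc b, ← add_assoc b]
          field_simp
          ring_nf

/-- The Borwein–Borwein evaluation of multivariable sinc integrals: for positive reals
`a₀, a₁, …, aₙ`,
`(2/π) ∫₀^∞ ∏_{i=0}^n (sin aᵢx / x) dx
  = (1/(2^n n!)) ∑_{s ∈ Vₙ} ε_s α_s (a₀ + ∑ sᵢaᵢ)^n`,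
where `α_s` is the sign (1, 0, or −1) of `a₀ + ∑ sᵢaᵢ`. -/
theorem sinc_integral_eq_signed_sum
    (n : ℕ) (hn : 0 < n) (a : Fin (n + 1) → ℝ) (ha : ∀ i, 0 < a i) :
    (2 / π) * ∫ x in Set.Ioi (0 : ℝ), ∏ i, Real.sin (a i * x) / x =
      (1 / ((2 : ℝ) ^ n * (n.factorial : ℝ))) *
        ∑ s : Fin n → Bool,
          (∏ i, (if s i then (1 : ℝ) else -1)) *
            Real.sign (a 0 + ∑ i, (if s i then (1 : ℝ) else -1) * a i.succ) *
            (a 0 + ∑ i, (if s i then (1 : ℝ) else -1) * a i.succ) ^ n := by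
  obtain ⟨m, rfl⟩ := Nat.exists_eq_succ_of_ne_zero hn.ne'
  have habs (y : ℝ) : |y| * y ^ m = sign y * y ^ (m + 1) := by
    rcases lt_trichotomy y 0 with h | rfl | h
    · rw [abs_of_neg h, sign_of_neg h]; ring
    · simp
    · rw [abs_of_pos h, sign_of_pos h]; ring
  simp only [Nat.succ_eq_add_one, Fin.prod_univ_succ (n := m + 1), integral_sin_mul_div_mul_prod, habs, ← mul_assoc]
  field_simp
end

section
/- Let n be a positive integer, let w ∈ ℝⁿ have all nonzero components, and let θ be a positive real number. Setting v' := (θ, w₁,…,wₙ) ∈ ℝ^{n+1}, one has vol_n(S_{w,θ}ⁿ ∩ Cⁿ) = θ/wₙ + (1/(2^{n−1} n! ∏_{i=1}^n wᵢ)) Σ_{s ∈ V_{n+1}^−} ε_s (v'·s)₊ⁿ. -/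
open MeasureTheory Finset

/-- The sign `±1` encoded by a Boolean. -/
noncomputable def boolSign (b : Bool) : ℝ := if b then 1 else -1

/-- The truncated power `r ↦ r₊^n`, with the convention that the zeroth power is the
Heaviside function. -/
noncomputable def truncPow (n : ℕ) (r : ℝ) : ℝ := if 0 ≤ r then r ^ n else 0

theorem boolSign_not (b : Bool) : boolSign (!b) = -boolSign b := by
  cases b <;> simp [boolSign]

theorem truncPow_succ (n : ℕ) (r : ℝ) : truncPow (n + 1) r = (max r 0) ^ (n + 1) := by
  unfold truncPow
  split_ifs with h
  · rw [max_eq_left h]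
  · rw [max_eq_right (not_le.mp h).le, zero_pow n.succ_ne_zero]

theorem continuous_truncPow_succ (n : ℕ) : Continuous (truncPow (n + 1)) := by
  rw [funext (truncPow_succ n)]
  fun_prop

theorem hasDerivWithinAt_truncPow_succ (n : ℕ) (r : ℝ) :
    HasDerivWithinAt (truncPow (n + 1)) ((n + 1) * truncPow n r) (Set.Ioi r) r := by
  rcases le_or_gt 0 r with h | h
  · have h1 : HasDerivWithinAt (fun x : ℝ => x ^ (n + 1)) ((n + 1) * truncPow n r)
        (Set.Ioi r) r := by
      simpa [truncPow, h] using (hasDerivAt_pow (n + 1) r).hasDerivWithinAt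
    refine h1.congr (fun x hx => ?_) ?_
    · simp [truncPow, h.trans (le_of_lt hx)]
    · simp [truncPow, h]
  · have h1 : HasDerivAt (fun _ : ℝ => (0 : ℝ)) ((n + 1) * truncPow n r) r := by
      simpa [truncPow, not_le.mpr h] using hasDerivAt_const r (0 : ℝ)
    refine (h1.congr_of_eventuallyEq ?_).hasDerivWithinAt
    filter_upwards [Iio_mem_nhds h] with x hx
    simp [truncPow, not_le.mpr (Set.mem_Iio.mp hx)]

theorem monotone_truncPow (n : ℕ) : Monotone (truncPow n) := by
  intro a b hab
  unfold truncPow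
  split_ifs with h1 h2 h2
  · gcongr
  · exact absurd (h1.trans hab) h2
  · positivity
  · rfl

theorem intervalIntegrable_truncPow (n : ℕ) (a b : ℝ) :
    IntervalIntegrable (truncPow n) volume a b :=
  (monotone_truncPow n).intervalIntegrable

theorem integral_truncPow (n : ℕ) (a b : ℝ) :
    ∫ x in a..b, truncPow n x = (truncPow (n + 1) b - truncPow (n + 1) a) / (n + 1) := by
  have h := intervalIntegral.integral_eq_sub_of_hasDeriv_right (a := a) (b := b)
    (continuous_truncPow_succ n).continuousOn
    (fun x _ => hasDerivWithinAt_truncPow_succ n x)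
    ((intervalIntegrable_truncPow n a b).const_mul _)
  rw [intervalIntegral.integral_const_mul] at h
  rw [← h]
  field_simp

theorem integral_truncPow_sub_mul (n : ℕ) (c : ℝ) {a : ℝ} (ha : a ≠ 0) :
    ∫ y in (-(1 / 2 : ℝ))..(1 / 2), truncPow n (c - a * y) =
      (truncPow (n + 1) (c + a / 2) - truncPow (n + 1) (c - a / 2)) / ((n + 1) * a) := by
  rw [intervalIntegral.integral_comp_sub_mul (truncPow n) ha, integral_truncPow, smul_eq_mul,
    show c - a * (1 / 2) = c - a / 2 by ring, show c - a * -(1 / 2) = c + a / 2 by ring]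
  field_simp

theorem sum_cons_bool {n : ℕ} (f : (Fin (n + 1) → Bool) → ℝ) :
    ∑ s, f s = ∑ s : Fin n → Bool, (f (Fin.cons true s) + f (Fin.cons false s)) := by
  rw [← (Fin.consEquiv fun _ => Bool).sum_comp, Fintype.sum_prod_type, Fintype.sum_bool,
    Finset.sum_add_distrib]
  rfl

theorem sum_snoc_bool {n : ℕ} (f : (Fin (n + 1) → Bool) → ℝ) :
    ∑ s, f s = ∑ s : Fin n → Bool, (f (Fin.snoc s true) + f (Fin.snoc s false)) := by
  rw [← (Fin.snocEquiv fun _ => Bool).sum_comp, Fintype.sum_prod_type, Fintype.sum_bool,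
    Finset.sum_add_distrib]
  rfl

theorem volume_halfSpace_inter_cube_succ {n : ℕ} (w : Fin (n + 1) → ℝ) (t : ℝ) :
    (volume ({x : Fin (n + 1) → ℝ | ∑ i, w i * x i ≤ t} ∩
        Set.Icc (fun _ => -(1/2 : ℝ)) (fun _ => (1/2 : ℝ)))).toReal =
      ∫ y in (-(1 / 2 : ℝ))..(1 / 2),
        (volume ({x : Fin n → ℝ | ∑ i, w i.succ * x i ≤ t - w 0 * y} ∩
        Set.Icc (fun _ => -(1/2 : ℝ)) (fun _ => (1/2 : ℝ)))).toReal := by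
  set S := {x : Fin (n + 1) → ℝ | ∑ i, w i * x i ≤ t} ∩
        Set.Icc (fun _ => -(1/2 : ℝ)) (fun _ => (1/2 : ℝ)) with hS
  have hSm : MeasurableSet S :=
    (measurableSet_le (by fun_prop) measurable_const).inter measurableSet_Icc
  have hmp := (volume_preserving_piFinSuccAbove (fun _ : Fin (n + 1) => ℝ) 0).symm
  have hslice (y : ℝ) : volume (Prod.mk y ⁻¹'
      ((MeasurableEquiv.piFinSuccAbove (fun _ : Fin (n + 1) => ℝ) 0).symm ⁻¹' S)) =
      (Set.Icc (-(1 / 2 : ℝ)) (1 / 2)).indicator (fun y =>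
        volume ({x : Fin n → ℝ | ∑ i, w i.succ * x i ≤ t - w 0 * y} ∩
        Set.Icc (fun _ => -(1/2 : ℝ)) (fun _ => (1/2 : ℝ)))) y := by
    have hmem (x : Fin n → ℝ) : x ∈ (Prod.mk y ⁻¹'
        ((MeasurableEquiv.piFinSuccAbove (fun _ : Fin (n + 1) => ℝ) 0).symm ⁻¹' S)) ↔
        y ∈ Set.Icc (-(1 / 2 : ℝ)) (1 / 2) ∧
        x ∈ {x : Fin n → ℝ | ∑ i, w i.succ * x i ≤ t - w 0 * y} ∩
          Set.Icc (fun _ => -(1/2 : ℝ)) (fun _ => (1/2 : ℝ)) := by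
      change (Fin.insertNth 0 y x : Fin (n + 1) → ℝ) ∈ S ↔ _
      simp only [Fin.insertNth_zero', hS, Set.mem_inter_iff, Set.mem_ofPred_eq, Set.mem_Icc,
        Pi.le_def, Fin.forall_fin_succ, Fin.sum_univ_succ, Fin.cons_zero, Fin.cons_succ,
        le_sub_iff_add_le']
      tauto
    by_cases hy : y ∈ Set.Icc (-(1 / 2 : ℝ)) (1 / 2)
    · rw [Set.indicator_of_mem hy]
      congr 1
      ext x
      rw [hmem]
      exact and_iff_right hy
    · rw [Set.indicator_of_notMem hy]
      convert measure_empty (μ := (volume : Measure (Fin n → ℝ)))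
      ext x
      rw [hmem]
      simp only [hy, false_and, Set.mem_empty_iff_false]
  have hfin (y : ℝ) : volume ({x : Fin n → ℝ | ∑ i, w i.succ * x i ≤ t - w 0 * y} ∩
        Set.Icc (fun _ => -(1/2 : ℝ)) (fun _ => (1/2 : ℝ))) < ⊤ :=
    (measure_mono Set.inter_subset_right).trans_lt isCompact_Icc.measure_lt_top
  have hTm := hmp.measurable hSm
  rw [← hmp.measure_preimage_equiv S, Measure.volume_eq_prod, Measure.prod_apply hTm,
    ← integral_toReal (measurable_measure_prodMk_left hTm).aemeasurable,
    intervalIntegral.integral_of_le (by norm_num), ← integral_Icc_eq_integral_Ioc,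
    ← integral_indicator measurableSet_Icc]
  · refine integral_congr_ae (Filter.Eventually.of_forall fun y => ?_)
    simp only
    rw [hslice]
    by_cases hy : y ∈ Set.Icc (-(1 / 2 : ℝ)) (1 / 2)
    · rw [Set.indicator_of_mem hy, Set.indicator_of_mem hy]
    · rw [Set.indicator_of_notMem hy, Set.indicator_of_notMem hy, ENNReal.toReal_zero]
  · refine Filter.Eventually.of_forall fun y => ?_
    rw [hslice]
    exact (Set.indicator_le_self _ _ y).trans_lt (hfin y)

theorem volume_halfSpace_inter_cube (n : ℕ) (w : Fin n → ℝ) (hw : ∀ i, w i ≠ 0) (t : ℝ) :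
    (volume ({x : Fin n → ℝ | ∑ i, w i * x i ≤ t} ∩
        Set.Icc (fun _ => -(1/2 : ℝ)) (fun _ => (1/2 : ℝ)))).toReal =
      (1 / ((n.factorial : ℝ) * ∏ i, w i)) * ∑ s : Fin n → Bool,
        (∏ i, boolSign (s i)) * truncPow n (t + (∑ i, w i * boolSign (s i)) / 2) := by
  induction n generalizing t with
  | zero =>
    by_cases ht : 0 ≤ t
    · have h : ({x : Fin 0 → ℝ | ∑ i, w i * x i ≤ t} ∩
        Set.Icc (fun _ => -(1/2 : ℝ)) (fun _ => (1/2 : ℝ))) = {default} := by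
        ext x
        simp [ht, eq_iff_true_of_subsingleton]
      rw [h, volume_pi, Measure.pi_of_empty _ default, Measure.dirac_apply_of_mem (Set.mem_singleton _)]
      simp [truncPow, ht]
    · simp [truncPow, ht]
  | succ n ih =>
    have hw0 := hw 0
    rw [volume_halfSpace_inter_cube_succ]
    simp_rw [ih (fun i => w i.succ) (fun i => hw i.succ)]
    rw [intervalIntegral.integral_const_mul, intervalIntegral.integral_finsetSum]
    · have hterm (s : Fin n → Bool) : ∫ y in (-(1 / 2 : ℝ))..(1 / 2), (∏ i, boolSign (s i)) *
          truncPow n (t - w 0 * y + (∑ i, w (Fin.succ i) * boolSign (s i)) / 2) =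
          (1 / ((n + 1) * w 0)) * ((∏ i, boolSign (s i)) *
            (truncPow (n + 1) (t + (∑ i, w i.succ * boolSign (s i)) / 2 + w 0 / 2) -
            truncPow (n + 1) (t + (∑ i, w i.succ * boolSign (s i)) / 2 - w 0 / 2))) := by
        rw [intervalIntegral.integral_const_mul]
        simp_rw [sub_add_eq_add_sub]
        rw [integral_truncPow_sub_mul n _ hw0]
        ring
      simp_rw [hterm]
      rw [← Finset.mul_sum, ← mul_assoc, sum_cons_bool]
      congr 1
      · rw [Fin.prod_univ_succ, Nat.factorial_succ]
        push_cast
        rw [div_mul_div_comm]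
        congr 1 <;> ring
      · refine Finset.sum_congr rfl fun s _ => ?_
        simp only [Fin.prod_univ_succ, Fin.sum_univ_succ, Fin.cons_zero, Fin.cons_succ]
        simp only [boolSign, if_true, Bool.false_eq_true, if_false]
        ring_nf
    · intro s _
      refine IntervalIntegrable.const_mul ?_ _
      have h := (intervalIntegrable_truncPow n (t + (∑ i, w i.succ * boolSign (s i)) / 2 -
        w 0 * -(1 / 2)) (t + (∑ i, w i.succ * boolSign (s i)) / 2 -
        w 0 * (1 / 2))).comp_sub_left (t + (∑ i, w i.succ * boolSign (s i)) / 2)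
      have h2 := h.comp_mul_left (c := w 0)
      simp only [sub_sub_cancel, mul_div_cancel_left₀ _ hw0] at h2
      simpa only [sub_add_eq_add_sub] using h2

/-- The alternating sum over sign vectors of `(c + u·s)^(m+1)`. -/
theorem sum_boolSign_mul_add_pow (m : ℕ) (u : Fin m → ℝ) (c : ℝ) :
    ∑ s : Fin m → Bool, (∏ i, boolSign (s i)) * (c + ∑ i, u i * boolSign (s i)) ^ (m + 1) =
      2 ^ m * (m + 1).factorial * (∏ i, u i) * c := by
  induction m generalizing c with
  | zero => simp
  | succ m ih =>
    have hterm (s : Fin m → Bool) : ∫ y in (c - u 0)..(c + u 0), (∏ i, boolSign (s i)) *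
        (y + ∑ i : Fin m, u i.succ * boolSign (s i)) ^ (m + 1) =
        (1 / ((m : ℝ) + 2)) * ((∏ i, boolSign (s i)) *
        ((c + u 0 + ∑ i : Fin m, u i.succ * boolSign (s i)) ^ (m + 2) -
        (c - u 0 + ∑ i : Fin m, u i.succ * boolSign (s i)) ^ (m + 2))) := by
      rw [intervalIntegral.integral_const_mul,
        intervalIntegral.integral_comp_add_right (fun y => y ^ (m + 1)), integral_pow]
      push_cast
      ring
    have key : ∫ y in (c - u 0)..(c + u 0), ∑ s : Fin m → Bool, (∏ i, boolSign (s i)) *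
        (y + ∑ i : Fin m, u i.succ * boolSign (s i)) ^ (m + 1) =
        ∫ y in (c - u 0)..(c + u 0), 2 ^ m * (m + 1).factorial * (∏ i : Fin m, u i.succ) * y := by
      simp_rw [ih (fun i => u i.succ)]
    rw [intervalIntegral.integral_finsetSum
      (fun s _ => Continuous.intervalIntegrable (by fun_prop) _ _),
      intervalIntegral.integral_const_mul, integral_id] at key
    simp_rw [hterm] at key
    rw [← Finset.mul_sum] at key
    have hsum : ∑ s : Fin (m + 1) → Bool, (∏ i, boolSign (s i)) *
        (c + ∑ i, u i * boolSign (s i)) ^ (m + 1 + 1) =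
        ∑ s : Fin m → Bool, (∏ i, boolSign (s i)) *
        ((c + u 0 + ∑ i : Fin m, u i.succ * boolSign (s i)) ^ (m + 2) -
        (c - u 0 + ∑ i : Fin m, u i.succ * boolSign (s i)) ^ (m + 2)) := by
      rw [sum_cons_bool]
      refine Finset.sum_congr rfl fun s _ => ?_
      simp only [Fin.prod_univ_succ, Fin.sum_univ_succ, Fin.cons_zero, Fin.cons_succ]
      simp only [boolSign, if_true, Bool.false_eq_true, if_false]
      ring
    rw [hsum, Fin.prod_univ_succ, Nat.factorial_succ (m + 1)]
    have hm : (m : ℝ) + 2 ≠ 0 := by positivity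
    field_simp at key
    push_cast
    linear_combination key / 2

/-- Reversing all signs in an alternating sum over sign vectors. -/
theorem sum_boolSign_neg (m : ℕ) (u : Fin m → ℝ) (g : ℝ → ℝ) :
    ∑ s : Fin m → Bool, (∏ i, boolSign (s i)) * g (∑ i, u i * boolSign (s i)) =
      (-1) ^ m * ∑ s : Fin m → Bool, (∏ i, boolSign (s i)) *
        g (-∑ i, u i * boolSign (s i)) := by
  rw [← (Equiv.arrowCongr (Equiv.refl (Fin m)) Equiv.boolNot).sum_comp, Finset.mul_sum]
  refine Finset.sum_congr rfl fun s _ => ?_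
  simp [boolSign_not, Finset.prod_neg, mul_assoc]

theorem max_pow_add_neg_one_pow_mul (m : ℕ) (r : ℝ) :
    (max r 0) ^ (m + 1) - (-1) ^ m * (max (-r) 0) ^ (m + 1) = r ^ (m + 1) := by
  rcases le_total 0 r with h | h
  · rw [max_eq_left h, max_eq_right (neg_nonpos.mpr h)]
    simp
  · rw [max_eq_right h, max_eq_left (neg_nonneg.mpr h), neg_pow r, pow_succ (-1 : ℝ),
      zero_pow m.succ_ne_zero]
    rcases neg_one_pow_eq_or ℝ m with h1 | h1 <;> rw [h1] <;> ring

/-- The central slab of half-width `t` has the volume `2 vol {w·x ≤ t} - 1` in the cube. -/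
theorem volume_abs_le_inter_cube (n : ℕ) (w : Fin n → ℝ) {t : ℝ} (ht : 0 ≤ t) :
    (volume ({x : Fin n → ℝ | |∑ i, w i * x i| ≤ t} ∩
        Set.Icc (fun _ => -(1/2 : ℝ)) (fun _ => (1/2 : ℝ)))).toReal =
      2 * (volume ({x : Fin n → ℝ | ∑ i, w i * x i ≤ t} ∩
        Set.Icc (fun _ => -(1/2 : ℝ)) (fun _ => (1/2 : ℝ)))).toReal - 1 := by
  set C : Set (Fin n → ℝ) := Set.Icc (fun _ => -(1/2 : ℝ)) (fun _ => (1/2 : ℝ)) with hC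
  set A := {x : Fin n → ℝ | ∑ i, w i * x i ≤ t} ∩ C with hA
  have hfin {B : Set (Fin n → ℝ)} (hB : B ⊆ C) : volume B ≠ ⊤ :=
    ((measure_mono hB).trans_lt isCompact_Icc.measure_lt_top).ne
  have hAm : MeasurableSet A :=
    (measurableSet_le (by fun_prop) measurable_const).inter measurableSet_Icc
  have hmem (x : Fin n → ℝ) : x ∈ -A ↔ -t ≤ ∑ i, w i * x i ∧ x ∈ C := by
    simp only [hA, hC, Set.mem_neg, Set.mem_inter_iff, Set.mem_ofPred_eq, Set.mem_Icc, Pi.le_def,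
      Pi.neg_apply, mul_neg, Finset.sum_neg_distrib, neg_le_neg_iff, neg_le (a := t)]
    simp only [neg_le (b := t), neg_le (b := (1 / 2 : ℝ))]
    tauto
  have hU : A ∪ -A = C := by
    ext x
    rw [Set.mem_union, hmem]
    constructor
    · rintro (h | h) <;> exact h.2
    · intro h
      rcases le_total (∑ i, w i * x i) t with h1 | h1
      · exact Or.inl ⟨h1, h⟩
      · exact Or.inr ⟨by linarith, h⟩
  have hI : A ∩ -A = {x : Fin n → ℝ | |∑ i, w i * x i| ≤ t} ∩ C := by
    ext x
    rw [Set.mem_inter_iff, hmem]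
    simp only [hA, Set.mem_inter_iff, Set.mem_ofPred_eq, abs_le]
    tauto
  have h := measure_union_add_inter' (μ := volume) hAm (-A)
  rw [hU, hI, Measure.measure_neg] at h
  have h' := congrArg ENNReal.toReal h
  rw [ENNReal.toReal_add (hfin subset_rfl) (hfin Set.inter_subset_right),
    ENNReal.toReal_add (hfin Set.inter_subset_right) (hfin Set.inter_subset_right)] at h'
  have hone : (volume C).toReal = 1 := by
    rw [hC, Real.volume_Icc_pi_toReal fun _ => by norm_num]
    norm_num
  linarith

/-- A second alternative formula for the volume of a central slab of the centered unit
cube: with `v' = (θ, w₁,…,wₙ)`,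
`vol_n(S_{w,θ}^n ∩ C^n) = θ/wₙ + (1/(2^{n-1} n! ∏ wᵢ)) ∑_{s ∈ V_{n+1}⁻} ε_s (v'·s)₊^n`,
where `V_{n+1}⁻` consists of sign vectors whose last coordinate is `-1`. -/
theorem volume_centralSlab_inter_centeredCube''
    (n : ℕ) (hn : 0 < n) (w : Fin n → ℝ) (hw : ∀ i, w i ≠ 0) (θ : ℝ) (hθ : 0 < θ) :
    (volume ({x : Fin n → ℝ | |∑ i, w i * x i| ≤ θ / 2} ∩
        Set.Icc (fun _ => -(1/2 : ℝ)) (fun _ => (1/2 : ℝ)))).toReal =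
      θ / w ⟨n - 1, by omega⟩ +
      (1 / ((2 : ℝ) ^ (n - 1) * (n.factorial : ℝ) * ∏ i, w i)) *
        ∑ s ∈ Finset.univ.filter (fun s : Fin (n + 1) → Bool => s (Fin.last n) = false),
          (∏ i, (if s i then (1 : ℝ) else -1)) *
            (max (∑ i, (Fin.cons θ w : Fin (n + 1) → ℝ) i * (if s i then (1 : ℝ) else -1))
              0) ^ n := by
  obtain ⟨m, rfl⟩ : ∃ m, n = m + 1 := ⟨n - 1, by omega⟩
  have hlast : (⟨m + 1 - 1, by omega⟩ : Fin (m + 1)) = Fin.last m := rfl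
  rw [hlast, volume_abs_le_inter_cube (m + 1) w (by positivity),
    volume_halfSpace_inter_cube (m + 1) w hw]
  have hscale (s : Fin (m + 1) → Bool) :
      truncPow (m + 1) (θ / 2 + (∑ i, w i * boolSign (s i)) / 2) =
      (1 / 2 ^ (m + 1)) * (max (θ + ∑ i, w i * boolSign (s i)) 0) ^ (m + 1) := by
    rw [truncPow_succ, ← one_div_pow, ← mul_pow, mul_max_of_nonneg _ _ (by norm_num)]
    ring_nf
  simp_rw [hscale]
  rw [Finset.sum_filter]
  change _ = _ + _ * ∑ s : Fin (m + 1 + 1) → Bool, if s (Fin.last (m + 1)) = false then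
    (∏ i, boolSign (s i)) * (max (∑ i, (Fin.cons θ w : Fin (m + 1 + 1) → ℝ) i *
      boolSign (s i)) 0) ^ (m + 1) else 0
  rw [sum_snoc_bool, sum_cons_bool (n := m + 1), sum_snoc_bool (n := m)]
  simp only [← Fin.succ_last, Fin.cons_succ, Fin.snoc_last,
    Fin.prod_univ_succ (n := m + 1), Fin.sum_univ_succ (n := m + 1), Fin.cons_zero,
    Fin.prod_univ_castSucc (n := m), Fin.sum_univ_castSucc (n := m), Fin.snoc_castSucc,
    Bool.true_eq_false, if_false, if_true, zero_add, add_zero]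
  simp only [show boolSign true = 1 from rfl, show boolSign false = -1 from rfl]
  set u : Fin m → ℝ := fun i => w i.castSucc with hu
  set a := w (Fin.last m) with ha
  have hU : ∏ i, u i ≠ 0 := Finset.prod_ne_zero_iff.mpr fun i _ => hw _
  have ha0 : a ≠ 0 := hw _
  have hpoly := sum_boolSign_mul_add_pow m u (θ + a)
  have hflip := sum_boolSign_neg m u (fun r => (max (r - (θ + a)) 0) ^ (m + 1))
  have hsplit : ∑ s : Fin m → Bool, (∏ i, boolSign (s i)) *
      (θ + a + ∑ i, u i * boolSign (s i)) ^ (m + 1) =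
      (∑ s : Fin m → Bool, (∏ i, boolSign (s i)) *
        (max (θ + a + ∑ i, u i * boolSign (s i)) 0) ^ (m + 1)) -
      ∑ s : Fin m → Bool, (∏ i, boolSign (s i)) *
        (max (∑ i, u i * boolSign (s i) - (θ + a)) 0) ^ (m + 1) := by
    rw [hflip, Finset.mul_sum, ← Finset.sum_sub_distrib]
    refine Finset.sum_congr rfl fun s _ => ?_
    rw [← max_pow_add_neg_one_pow_mul]
    ring_nf
  rw [hsplit] at hpoly
  have hleft : ∑ s : Fin m → Bool, ((∏ i, boolSign (s i)) * 1 * (1 / 2 ^ (m + 1) *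
      (max (θ + (∑ i, u i * boolSign (s i) + a * 1)) 0) ^ (m + 1)) +
      (∏ i, boolSign (s i)) * -1 * (1 / 2 ^ (m + 1) *
      (max (θ + (∑ i, u i * boolSign (s i) + a * -1)) 0) ^ (m + 1))) =
      1 / 2 ^ (m + 1) * (∑ s : Fin m → Bool, (∏ i, boolSign (s i)) *
        (max (θ + a + ∑ i, u i * boolSign (s i)) 0) ^ (m + 1) -
      ∑ s : Fin m → Bool, (∏ i, boolSign (s i)) *
        (max (θ - a + ∑ i, u i * boolSign (s i)) 0) ^ (m + 1)) := by
    rw [← Finset.sum_sub_distrib, Finset.mul_sum]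
    refine Finset.sum_congr rfl fun s _ => ?_
    ring_nf
  have hright : ∑ s : Fin m → Bool, (1 * ((∏ i, boolSign (s i)) * -1) *
      (max (θ * 1 + (∑ i, u i * boolSign (s i) + a * -1)) 0) ^ (m + 1) +
      -1 * ((∏ i, boolSign (s i)) * -1) *
      (max (θ * -1 + (∑ i, u i * boolSign (s i) + a * -1)) 0) ^ (m + 1)) =
      (∑ s : Fin m → Bool, (∏ i, boolSign (s i)) *
        (max (∑ i, u i * boolSign (s i) - (θ + a)) 0) ^ (m + 1)) -
      ∑ s : Fin m → Bool, (∏ i, boolSign (s i)) *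
        (max (θ - a + ∑ i, u i * boolSign (s i)) 0) ^ (m + 1) := by
    rw [← Finset.sum_sub_distrib]
    refine Finset.sum_congr rfl fun s _ => ?_
    ring_nf
  rw [hleft, hright, sub_eq_iff_eq_add.mp hpoly, Nat.add_sub_cancel]
  have hf : ((m + 1).factorial : ℝ) ≠ 0 := by positivity
  field_simp
  ring
end

section
/- Let n be a positive integer, let w₁,…,wₙ ∈ ℂ, and let λ ∈ ℂ. Then Σ_{K ⊆ [n]} (-1)^{|K|} (λ + Σ_{i∈K} wᵢ)ⁿ = (-1)ⁿ n! ∏_{i=1}^n wᵢ. -/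
open Finset

section AlternatingPowerSum

variable {ι R : Type*} [DecidableEq ι] [CommRing R]

/-- Enlarging the index set by `a` expresses the alternating sum of `m`-th powers through the
alternating sums of lower powers over the original set. -/
theorem sum_powerset_insert_neg_one_pow_card_mul_pow {s : Finset ι} {a : ι} (ha : a ∉ s)
    (w : ι → R) (x : R) (m : ℕ) :
    ∑ K ∈ (insert a s).powerset, (-1 : R) ^ K.card * (x + ∑ i ∈ K, w i) ^ m =
      -∑ j ∈ range m, w a ^ (m - j) * (m.choose j : R) *
        ∑ K ∈ s.powerset, (-1 : R) ^ K.card * (x + ∑ i ∈ K, w i) ^ j := by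
  have hshift : ∀ K ∈ s.powerset,
      (-1 : R) ^ (insert a K).card * (x + ∑ i ∈ insert a K, w i) ^ m =
        -((-1 : R) ^ K.card * (x + ∑ i ∈ K, w i) ^ m) -
          ∑ j ∈ range m, w a ^ (m - j) * (m.choose j : R) *
            ((-1 : R) ^ K.card * (x + ∑ i ∈ K, w i) ^ j) := by
    intro K hK
    have haK : a ∉ K := fun h => ha (mem_powerset.1 hK h)
    rw [card_insert_of_notMem haK, sum_insert haK,
      show x + (w a + ∑ i ∈ K, w i) = (x + ∑ i ∈ K, w i) + w a by ring,
      add_pow, sum_range_succ, Nat.sub_self, Nat.choose_self, mul_add, mul_sum, pow_succ,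
      sub_eq_add_neg, ← sum_neg_distrib, add_comm]
    congr 1
    · simp
    · exact sum_congr rfl fun j _ => by ring
  rw [sum_powerset_insert ha, sum_congr rfl hshift, sum_sub_distrib, sum_neg_distrib, sum_comm]
  simp only [mul_sum]
  ring

/-- The alternating sum of `m`-th powers over subsets of `s` vanishes when `m < #s`. -/
theorem sum_powerset_neg_one_pow_card_mul_pow_eq_zero (s : Finset ι) (w : ι → R) (x : R)
    {m : ℕ} (hm : m < s.card) :
    ∑ K ∈ s.powerset, (-1 : R) ^ K.card * (x + ∑ i ∈ K, w i) ^ m = 0 := by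
  induction s using Finset.induction_on generalizing m with
  | empty => simp at hm
  | insert a s ha ih =>
    rw [card_insert_of_notMem ha] at hm
    rw [sum_powerset_insert_neg_one_pow_card_mul_pow ha, neg_eq_zero]
    refine sum_eq_zero fun j hj => ?_
    rw [ih (by have := mem_range.1 hj; omega), mul_zero]

/-- The alternating sum of `#s`-th powers over subsets of `s`. -/
theorem sum_powerset_neg_one_pow_card_mul_pow_card (s : Finset ι) (w : ι → R) (x : R) :
    ∑ K ∈ s.powerset, (-1 : R) ^ K.card * (x + ∑ i ∈ K, w i) ^ s.card =
      (-1 : R) ^ s.card * (s.card.factorial : R) * ∏ i ∈ s, w i := by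
  induction s using Finset.induction_on with
  | empty => simp
  | insert a s ha ih =>
    rw [sum_powerset_insert_neg_one_pow_card_mul_pow ha, card_insert_of_notMem ha,
      sum_range_succ, sum_eq_zero, ih, prod_insert ha, Nat.factorial_succ,
      Nat.choose_succ_self_right, Nat.add_sub_cancel_left]
    · push_cast
      ring
    · intro j hj
      rw [sum_powerset_neg_one_pow_card_mul_pow_eq_zero s w x (mem_range.1 hj), mul_zero]

end AlternatingPowerSum

/-- For complex numbers `w₁,…,wₙ, λ`, the alternating sum
`∑_{K ⊆ [n]} (-1)^{|K|} (λ + ∑_{i ∈ K} wᵢ)^n` equals `(-1)^n n! ∏ wᵢ`. -/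
theorem alternating_sum_pow_eq_factorial_prod
    (n : ℕ) (hn : 0 < n) (w : Fin n → ℂ) (lam : ℂ) :
    ∑ K : Finset (Fin n), (-1 : ℂ) ^ K.card * (lam + ∑ i ∈ K, w i) ^ n =
      (-1 : ℂ) ^ n * (n.factorial : ℂ) * ∏ i, w i := by
  simpa using sum_powerset_neg_one_pow_card_mul_pow_card univ w lam
end
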